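/- arXiv:0912.5011 — 4 statements merged into one kernel-verified Lean document; each statement's English description precedes it below -/
import Mathlib

section
/- For every natural number N ≥ 1 and every real x ≠ 0, the parastatistic bracket satisfies 0 ≤ 1/(e^x − 1) − N/(e^{Nx} − 1) ≤ N − 1. -/
/-- The parastatistic bracket is nonnegative: Bernoulli's inequality for `exp x`. -/
theorem parastat_bracket_nonneg (N : ℕ) (hN : 1 ≤ N) (x : ℝ) (hx : x ≠ 0) :
    0 ≤ 1 / (Real.exp x - 1) - (N : ℝ) / (Real.exp ((N : ℝ) * x) - 1) := by
  have hN0 : (0 : ℝ) < N := by exact_mod_cast hN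
  have hB : 1 + (N : ℝ) * (Real.exp x - 1) ≤ Real.exp ((N : ℝ) * x) := by
    have h := one_add_mul_le_pow (a := Real.exp x - 1) (by linarith [Real.exp_pos x]) N
    rwa [add_sub_cancel, ← Real.exp_nat_mul] at h
  have hprod : 0 < (Real.exp x - 1) * (Real.exp ((N : ℝ) * x) - 1) := by
    rcases hx.lt_or_gt with h | h
    · exact mul_pos_of_neg_of_neg (sub_neg.2 (Real.exp_lt_one_iff.2 h))
        (sub_neg.2 (Real.exp_lt_one_iff.2 (mul_neg_of_pos_of_neg hN0 h)))
    · exact mul_pos (sub_pos.2 (Real.one_lt_exp_iff.2 h))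
        (sub_pos.2 (Real.one_lt_exp_iff.2 (mul_pos hN0 h)))
  rw [div_sub_div _ _ (left_ne_zero_of_mul hprod.ne') (right_ne_zero_of_mul hprod.ne')]
  exact div_nonneg (by linarith) hprod.le

/-- Reflection formula for the Bose occupation number. -/
theorem one_div_exp_neg_sub_one {y : ℝ} (hy : y ≠ 0) :
    1 / (Real.exp (-y) - 1) = -1 - 1 / (Real.exp y - 1) := by
  have h : Real.exp y - 1 ≠ 0 := sub_ne_zero.2 fun e => hy ((Real.exp_eq_one_iff _).1 e)
  have h' : Real.exp (-y) - 1 ≠ 0 :=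
    sub_ne_zero.2 fun e => hy (neg_eq_zero.1 ((Real.exp_eq_one_iff _).1 e))
  have hmul : Real.exp (-y) * Real.exp y = 1 := by rw [← Real.exp_add]; simp
  field_simp
  linear_combination hmul

/-- For every `N ≥ 1` and real `x ≠ 0`, the parastatistic bracket satisfies
`0 ≤ 1/(e^x − 1) − N/(e^{Nx} − 1) ≤ N − 1`. -/
theorem parastat_bracket_bounds (N : ℕ) (hN : 1 ≤ N) (x : ℝ) (hx : x ≠ 0) :
    0 ≤ 1 / (Real.exp x - 1) - (N : ℝ) / (Real.exp ((N : ℝ) * x) - 1) ∧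
      1 / (Real.exp x - 1) - (N : ℝ) / (Real.exp ((N : ℝ) * x) - 1) ≤ (N : ℝ) - 1 := by
  have hNx : (N : ℝ) * x ≠ 0 := mul_ne_zero (by exact_mod_cast (by lia : N ≠ 0)) hx
  refine ⟨parastat_bracket_nonneg N hN x hx, ?_⟩
  have h := parastat_bracket_nonneg N hN (-x) (neg_ne_zero.2 hx)
  rw [mul_neg, div_eq_mul_one_div (N : ℝ), one_div_exp_neg_sub_one hx,
    one_div_exp_neg_sub_one hNx] at h
  rw [div_eq_mul_one_div (N : ℝ)]
  linarith
end

section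
/- Let N ≥ 2 be a natural number, μ > 0 and a > −1 real numbers. Then the function ε ↦ ε^a · (1/(e^{ε−μ} − 1) − N/(e^{N(ε−μ)} − 1)) is integrable on (0, ∞) (it is defined for ε ≠ μ, a set of full measure). -/
/-- For `y > 0`, the bracket `1/(y − 1) − N/(y^N − 1)` is bounded in absolute value by `N/y`. -/
theorem abs_one_div_sub_div_pow_sub_one_le {N : ℕ} (hN : 0 < N) {y : ℝ} (hy : 0 < y) :
    |1 / (y - 1) - (N : ℝ) / (y ^ N - 1)| ≤ N / y := by
  rcases eq_or_ne y 1 with rfl | hy1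
  · simp
  set S : ℝ := ∑ k ∈ Finset.range N, y ^ k with hS
  set Q : ℝ := ∑ k ∈ Finset.range N, ∑ j ∈ Finset.range k, y ^ j with hQ
  have hSpos : 0 < S := Finset.sum_pos (fun _ _ => pow_pos hy _) ⟨0, by simpa using hN⟩
  have hQnonneg : 0 ≤ Q :=
    Finset.sum_nonneg fun _ _ => Finset.sum_nonneg fun _ _ => pow_nonneg hy.le _
  have hsub : y - 1 ≠ 0 := sub_ne_zero.mpr hy1
  have hpow : y ^ N - 1 = S * (y - 1) := (geom_sum_mul y N).symm
  have hSN : S - N = Q * (y - 1) := by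
    rw [hQ, Finset.sum_mul]
    simp only [geom_sum_mul, Finset.sum_sub_distrib]
    simp [hS]
  have hQS : Q * y ≤ N * S := by
    have hle : ∀ k ∈ Finset.range N, (∑ j ∈ Finset.range k, y ^ j) * y ≤ S := by
      intro k hk
      calc (∑ j ∈ Finset.range k, y ^ j) * y
          ≤ ∑ j ∈ Finset.range (k + 1), y ^ j := by
            rw [Finset.sum_range_succ', Finset.sum_mul]
            simp [pow_succ]
        _ ≤ S := Finset.sum_le_sum_of_subset_of_nonneg
            (Finset.range_subset_range.mpr (Finset.mem_range.mp hk))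
            (fun _ _ _ => pow_nonneg hy.le _)
    rw [hQ, Finset.sum_mul]
    simpa using Finset.sum_le_sum hle
  have hbracket : 1 / (y - 1) - (N : ℝ) / (y ^ N - 1) = Q / S := by
    rw [hpow]
    field_simp
    linarith
  rw [hbracket, abs_of_nonneg (div_nonneg hQnonneg hSpos.le), div_le_div_iff₀ hSpos hy]
  exact hQS

/-- For `N ≥ 2`, `μ > 0` and `a > −1`, the parastatistic integrand
`ε ↦ ε^a (1/(e^{ε−μ} − 1) − N/(e^{N(ε−μ)} − 1))` is integrable on `(0, ∞)`. -/
theorem parastat_integrand_integrable (N : ℕ) (hN : 2 ≤ N) (μ a : ℝ)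
    (hμ : 0 < μ) (ha : -1 < a) :
    MeasureTheory.IntegrableOn
      (fun ε : ℝ => ε ^ a *
        (1 / (Real.exp (ε - μ) - 1) - (N : ℝ) / (Real.exp ((N : ℝ) * (ε - μ)) - 1)))
      (Set.Ioi 0) := by
  have hgamma : MeasureTheory.IntegrableOn
      (fun ε : ℝ => (N * Real.exp μ) * (Real.exp (-ε) * ε ^ a)) (Set.Ioi 0) := by
    have h := Real.GammaIntegral_convergent (s := a + 1) (by linarith)
    simp only [add_sub_cancel_right] at h
    exact h.const_mul _
  refine MeasureTheory.Integrable.mono' hgamma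
    (Measurable.aestronglyMeasurable (by fun_prop)) ?_
  filter_upwards [MeasureTheory.ae_restrict_mem measurableSet_Ioi] with ε hε
  have hbound := abs_one_div_sub_div_pow_sub_one_le (N := N) (by omega) (Real.exp_pos (ε - μ))
  rw [← Real.exp_nat_mul] at hbound
  have hrpow : 0 ≤ ε ^ a := Real.rpow_nonneg (le_of_lt hε) a
  rw [Real.norm_eq_abs, abs_mul, abs_of_nonneg hrpow]
  calc ε ^ a * |1 / (Real.exp (ε - μ) - 1) - (N : ℝ) / (Real.exp (N * (ε - μ)) - 1)|
      ≤ ε ^ a * (N / Real.exp (ε - μ)) := mul_le_mul_of_nonneg_left hbound hrpow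
    _ = (N * Real.exp μ) * (Real.exp (-ε) * ε ^ a) := by
      rw [div_eq_mul_inv, ← Real.exp_neg, neg_sub, sub_eq_add_neg, Real.exp_add]
      ring
end

section
/- Let μ > 0 and a > −1 be real numbers. Then, as the natural number N tends to infinity, (1/N) ∫₀^∞ ε^a · (1/(e^{ε−μ} − 1) − N/(e^{N(ε−μ)} − 1)) dε converges to μ^{a+1}/(a + 1). -/
open Filter Topology

/-- The normalized order-`N` parastatistic bracket, in the variable `y = e^x`, is the quotient of
`∑ (i < N), ∑ (j < i), y ^ j` by `N * ∑ (i < N), y ^ i`. -/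
lemma parastat_bracket_eq_div {y : ℝ} (hy : 0 < y) (hy1 : y ≠ 1) {N : ℕ} (hN : N ≠ 0) :
    (1 / (N : ℝ)) * (1 / (y - 1) - N / (y ^ N - 1)) =
      (∑ i ∈ Finset.range N, ∑ j ∈ Finset.range i, y ^ j) /
        (N * ∑ i ∈ Finset.range N, y ^ i) := by
  have hS : 0 < ∑ i ∈ Finset.range N, y ^ i :=
    Finset.sum_pos (fun i _ => pow_pos hy i) (Finset.nonempty_range_iff.2 hN)
  have hT : (∑ i ∈ Finset.range N, ∑ j ∈ Finset.range i, y ^ j) * (y - 1) =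
      (∑ i ∈ Finset.range N, y ^ i) - N := by
    rw [Finset.sum_mul]
    simp [geom_sum_mul]
  have hy1' : y - 1 ≠ 0 := sub_ne_zero.2 hy1
  have hN' : (N : ℝ) ≠ 0 := Nat.cast_ne_zero.2 hN
  rw [← geom_sum_mul y N]
  field_simp
  linear_combination -hT

/-- The normalized parastatistic bracket is dominated by a Boltzmann factor. -/
lemma abs_parastat_bracket_le {y : ℝ} (hy : 0 < y) (N : ℕ) :
    |(1 / (N : ℝ)) * (1 / (y - 1) - N / (y ^ N - 1))| ≤ 2 / y := by
  rcases eq_or_ne N 0 with rfl | hN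
  · simpa using by positivity
  rcases eq_or_ne y 1 with rfl | hy1
  · simp
  have hN0 : (0 : ℝ) < N := Nat.cast_pos.2 (Nat.pos_of_ne_zero hN)
  have hS : 0 < ∑ i ∈ Finset.range N, y ^ i :=
    Finset.sum_pos (fun i _ => pow_pos hy i) (Finset.nonempty_range_iff.2 hN)
  have h0 : 0 ≤ (1 / (N : ℝ)) * (1 / (y - 1) - N / (y ^ N - 1)) := by
    rw [parastat_bracket_eq_div hy hy1 hN]
    positivity
  rw [abs_of_nonneg h0]
  rcases le_total y 2 with hy2 | hy2
  · have h1 : (1 / (N : ℝ)) * (1 / (y - 1) - N / (y ^ N - 1)) ≤ 1 := by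
      rw [parastat_bracket_eq_div hy hy1 hN, div_le_one (by positivity)]
      calc ∑ i ∈ Finset.range N, ∑ j ∈ Finset.range i, y ^ j
          ≤ ∑ _i ∈ Finset.range N, ∑ j ∈ Finset.range N, y ^ j :=
            Finset.sum_le_sum fun i hi => Finset.sum_le_sum_of_subset_of_nonneg
              (Finset.range_mono (Finset.mem_range.1 hi).le) fun j _ _ => (pow_pos hy j).le
        _ = N * ∑ i ∈ Finset.range N, y ^ i := by simp
    exact h1.trans ((one_le_div hy).2 hy2)
  · have hp : 0 ≤ (N : ℝ) / (y ^ N - 1) :=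
      div_nonneg hN0.le (sub_nonneg.2 (one_le_pow₀ (by linarith)))
    have hq : 0 ≤ 1 / (y - 1) := one_div_nonneg.2 (by linarith)
    have hN1 : 1 / (N : ℝ) ≤ 1 :=
      (div_le_one hN0).2 (by exact_mod_cast Nat.one_le_iff_ne_zero.2 hN)
    calc (1 / (N : ℝ)) * (1 / (y - 1) - N / (y ^ N - 1))
        ≤ (1 / (N : ℝ)) * (1 / (y - 1)) := by gcongr; linarith
      _ ≤ 1 / (y - 1) := mul_le_of_le_one_left hq hN1
      _ ≤ 2 / y := by
        rw [div_le_div_iff₀ (by linarith) hy]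
        linarith

/-- The normalized parastatistic bracket converges pointwise to a step function. -/
lemma tendsto_parastat_bracket {y : ℝ} (hy : 0 < y) :
    Tendsto (fun N : ℕ => (1 / (N : ℝ)) * (1 / (y - 1) - N / (y ^ N - 1))) atTop
      (𝓝 (if y < 1 then 1 else 0)) := by
  have hsplit : (fun N : ℕ => (1 / (N : ℝ)) * (1 / (y - 1)) - (y ^ N - 1)⁻¹) =ᶠ[atTop]
      fun N : ℕ => (1 / (N : ℝ)) * (1 / (y - 1) - N / (y ^ N - 1)) := by
    filter_upwards [eventually_ne_atTop 0] with N hN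
    have hN' : (N : ℝ) ≠ 0 := Nat.cast_ne_zero.2 hN
    rw [mul_sub, div_eq_mul_inv (N : ℝ), ← mul_assoc, one_div_mul_cancel hN', one_mul]
  have h1 : Tendsto (fun N : ℕ => (1 / (N : ℝ)) * (1 / (y - 1))) atTop (𝓝 0) := by
    simpa using tendsto_one_div_atTop_nhds_zero_nat.mul_const (1 / (y - 1))
  refine Tendsto.congr' hsplit ?_
  rcases lt_trichotomy y 1 with h | rfl | h
  · have h2 := ((tendsto_pow_atTop_nhds_zero_of_lt_one hy.le h).sub_const 1).inv₀ (by norm_num)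
    simpa [h] using h1.sub h2
  · simp
  · have h2 : Tendsto (fun N : ℕ => (y ^ N - 1)⁻¹) atTop (𝓝 0) :=
      (tendsto_atTop_add_const_right _ (-1) (tendsto_pow_atTop_atTop_of_one_lt h)).inv_tendsto_atTop
    simpa [h.not_gt] using h1.sub h2

/-- As `N → ∞`, the normalized parastatistic energy integral converges:
`(1/N) ∫₀^∞ ε^a (1/(e^{ε−μ} − 1) − N/(e^{N(ε−μ)} − 1)) dε → μ^{a+1}/(a+1)`. -/
theorem parastat_normalized_integral_limit (μ a : ℝ) (hμ : 0 < μ) (ha : -1 < a) :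
    Tendsto (fun N : ℕ =>
        (1 / (N : ℝ)) * ∫ ε in Set.Ioi (0 : ℝ), ε ^ a *
          (1 / (Real.exp (ε - μ) - 1) - (N : ℝ) / (Real.exp ((N : ℝ) * (ε - μ)) - 1)))
      atTop (𝓝 (μ ^ (a + 1) / (a + 1))) := by
  have hlim : ∫ ε in Set.Ioi (0 : ℝ), ε ^ a * (if Real.exp (ε - μ) < 1 then 1 else 0) =
      μ ^ (a + 1) / (a + 1) := by
    have hind : (fun ε : ℝ => ε ^ a * (if Real.exp (ε - μ) < 1 then 1 else 0)) =
        (Set.Iio μ).indicator (fun ε => ε ^ a) := by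
      ext ε
      simp [Set.indicator_apply]
    rw [hind, MeasureTheory.setIntegral_indicator measurableSet_Iio, Set.Ioi_inter_Iio,
      ← MeasureTheory.integral_Ioc_eq_integral_Ioo, ← intervalIntegral.integral_of_le hμ.le,
      integral_rpow (Or.inl ha), Real.zero_rpow (by linarith), sub_zero]
  simp_rw [← MeasureTheory.integral_const_mul, mul_left_comm (1 / (_ : ℝ)), Real.exp_nat_mul]
  rw [← hlim]
  refine MeasureTheory.tendsto_integral_of_dominated_convergence
    (fun ε => 2 * Real.exp μ * (Real.exp (-ε) * ε ^ (a + 1 - 1))) ?_ ?_ ?_ ?_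
  · intro N
    exact Measurable.aestronglyMeasurable (by fun_prop)
  · exact (Real.GammaIntegral_convergent (by linarith)).const_mul _
  · intro N
    refine (MeasureTheory.ae_restrict_iff' measurableSet_Ioi).2
      (MeasureTheory.ae_of_all _ fun ε hε => ?_)
    have hε' : 0 ≤ ε ^ a := Real.rpow_nonneg (le_of_lt hε) a
    rw [Real.norm_eq_abs, abs_mul, abs_of_nonneg hε', add_sub_cancel_right]
    refine (mul_le_mul_of_nonneg_left (abs_parastat_bracket_le (Real.exp_pos _) N) hε').trans_eq ?_
    rw [Real.exp_sub, Real.exp_neg]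
    field_simp
  · exact MeasureTheory.ae_of_all _ fun ε => (tendsto_parastat_bracket (Real.exp_pos _)).const_mul _
end

section
/- Let μ > 0 and a > −1 be real numbers. Then, as the natural number N tends to infinity, the ratio (∫₀^∞ ε^{a+1} (1/(e^{ε−μ} − 1) − N/(e^{N(ε−μ)} − 1)) dε) / (∫₀^∞ ε^{a} (1/(e^{ε−μ} − 1) − N/(e^{N(ε−μ)} − 1)) dε) converges to μ(a + 1)/(a + 2). In particular, in the parastatistic limit the compressibility factor is proportional to the chemical potential μ. -/
open Filter Topology

lemma mul_exp_sub_one_pos {x : ℝ} (hx : x ≠ 0) : 0 < x * (Real.exp x - 1) := by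
  rcases lt_or_gt_of_ne hx with h | h
  · exact mul_pos_of_neg_of_neg h (by linarith [Real.exp_lt_one_iff.2 h])
  · exact mul_pos h (by linarith [Real.one_lt_exp_iff.2 h])

lemma exp_sub_one_ne_zero {x : ℝ} (hx : x ≠ 0) : Real.exp x - 1 ≠ 0 :=
  right_ne_zero_of_mul (mul_exp_sub_one_pos hx).ne'

lemma one_div_exp_sub_one_le_one_div {x : ℝ} (hx : x ≠ 0) :
    1 / (Real.exp x - 1) ≤ 1 / x := by
  have he := exp_sub_one_ne_zero hx
  have h : 1 / x - 1 / (Real.exp x - 1) = (Real.exp x - 1 - x) / (x * (Real.exp x - 1)) := by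
    field_simp
  have := div_nonneg (by linarith [Real.add_one_le_exp x] : 0 ≤ Real.exp x - 1 - x)
    (mul_exp_sub_one_pos hx).le
  linarith

lemma one_div_sub_one_le_one_div_exp_sub_one {x : ℝ} (hx : x ≠ 0) :
    1 / x - 1 ≤ 1 / (Real.exp x - 1) := by
  have he := exp_sub_one_ne_zero hx
  have h : 1 / (Real.exp x - 1) - (1 / x - 1) =
      (1 - Real.exp x * (1 - x)) / (x * (Real.exp x - 1)) := by
    field_simp
    ring
  have hnum : Real.exp x * (1 - x) ≤ 1 := by
    calc Real.exp x * (1 - x) ≤ Real.exp x * Real.exp (-x) := by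
          gcongr
          linarith [Real.add_one_le_exp (-x)]
      _ = 1 := by rw [← Real.exp_add]; simp
  have := div_nonneg (sub_nonneg.2 hnum) (mul_exp_sub_one_pos hx).le
  linarith

/-- The parastatistic occupation bracket of order `N`, divided by `N`. -/
noncomputable def scaledBracket (N : ℕ) (x : ℝ) : ℝ :=
  1 / (Real.exp x - 1) / N - 1 / (Real.exp (N * x) - 1)

lemma bracket_eq_mul_scaledBracket {N : ℕ} (hN : 1 ≤ N) (x : ℝ) :
    1 / (Real.exp x - 1) - (N : ℝ) / (Real.exp ((N : ℝ) * x) - 1) = N * scaledBracket N x := by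
  have : (N : ℝ) ≠ 0 := by positivity
  rw [scaledBracket, mul_sub, mul_div_cancel₀ _ this, mul_one_div]

lemma abs_scaledBracket_le {N : ℕ} (hN : 1 ≤ N) {x : ℝ} (hx : x ≠ 0) :
    |scaledBracket N x| ≤ Real.exp (1 - x) := by
  have hN1 : (1 : ℝ) ≤ N := by exact_mod_cast hN
  have hN0 : (0 : ℝ) < N := by linarith
  rcases lt_or_ge x 1 with h | h
  · have hNx : (N : ℝ) * x ≠ 0 := mul_ne_zero hN0.ne' hx
    have h1 := one_div_exp_sub_one_le_one_div hNx
    have h2 := one_div_sub_one_le_one_div_exp_sub_one hNx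
    have h3 := div_le_div_of_nonneg_right (one_div_exp_sub_one_le_one_div hx) hN0.le
    have h4 := div_le_div_of_nonneg_right (one_div_sub_one_le_one_div_exp_sub_one hx) hN0.le
    have h5 : 1 / x / N = 1 / (N * x) := by rw [div_div, mul_comm]
    have h6 : 1 / (N : ℝ) ≤ 1 := by rw [div_le_one hN0]; exact hN1
    rw [sub_div, h5] at h4
    rw [h5] at h3
    have h7 : 1 ≤ Real.exp (1 - x) := Real.one_le_exp (by linarith)
    rw [scaledBracket, abs_le]
    constructor <;> linarith
  · have he1 : 2 ≤ Real.exp 1 := by linarith [Real.add_one_le_exp 1]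
    have hex : 2 ≤ Real.exp x := he1.trans (Real.exp_le_exp.2 h)
    have hNx : Real.exp x ≤ Real.exp (N * x) := Real.exp_le_exp.2 (by nlinarith)
    have h1 : 1 / (Real.exp (N * x) - 1) ≤ 1 / (Real.exp x - 1) :=
      one_div_le_one_div_of_le (by linarith) (by linarith)
    have h2 : 0 ≤ 1 / (Real.exp (N * x) - 1) := one_div_nonneg.2 (by linarith)
    have h3 : 1 / (Real.exp x - 1) / N ≤ 1 / (Real.exp x - 1) :=
      div_le_self (one_div_nonneg.2 (by linarith)) hN1
    have h4 : 0 ≤ 1 / (Real.exp x - 1) / N :=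
      div_nonneg (one_div_nonneg.2 (by linarith)) hN0.le
    have h5 : 1 / (Real.exp x - 1) ≤ Real.exp (1 - x) := by
      rw [Real.exp_sub, div_le_div_iff₀ (by linarith) (Real.exp_pos x)]
      nlinarith
    rw [scaledBracket, abs_le]
    constructor <;> linarith

lemma tendsto_scaledBracket_of_neg {x : ℝ} (hx : x < 0) :
    Tendsto (fun N : ℕ => scaledBracket N x) atTop (𝓝 1) := by
  have h1 : Tendsto (fun N : ℕ => Real.exp ((N : ℝ) * x)) atTop (𝓝 0) :=
    Real.tendsto_exp_atBot.comp (tendsto_natCast_atTop_atTop.atTop_mul_const_of_neg hx)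
  have h2 : Tendsto (fun N : ℕ => 1 / (Real.exp ((N : ℝ) * x) - 1)) atTop (𝓝 (1 / (0 - 1))) :=
    tendsto_const_nhds.div (h1.sub_const 1) (by norm_num)
  simpa [scaledBracket] using (tendsto_const_div_atTop_nhds_zero_nat (1 / (Real.exp x - 1))).sub h2

lemma tendsto_scaledBracket_of_pos {x : ℝ} (hx : 0 < x) :
    Tendsto (fun N : ℕ => scaledBracket N x) atTop (𝓝 0) := by
  have h1 : Tendsto (fun N : ℕ => Real.exp ((N : ℝ) * x)) atTop atTop :=
    Real.tendsto_exp_atTop.comp (tendsto_natCast_atTop_atTop.atTop_mul_const hx)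
  have h2 : Tendsto (fun N : ℕ => 1 / (Real.exp ((N : ℝ) * x) - 1)) atTop (𝓝 0) :=
    (tendsto_atTop_add_const_right atTop (-1) h1).const_div_atTop 1
  simpa [scaledBracket] using (tendsto_const_div_atTop_nhds_zero_nat (1 / (Real.exp x - 1))).sub h2

open MeasureTheory Set in
lemma tendsto_integral_rpow_mul_scaledBracket {μ p : ℝ} (hμ : 0 < μ) (hp : -1 < p) :
    Tendsto (fun N : ℕ => ∫ ε in Ioi (0 : ℝ), ε ^ p * scaledBracket N (ε - μ)) atTop
      (𝓝 (μ ^ (p + 1) / (p + 1))) := by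
  have hlim : ∫ ε in Ioi (0 : ℝ), (Iic μ).indicator (fun ε => ε ^ p) ε =
      μ ^ (p + 1) / (p + 1) := by
    rw [setIntegral_indicator measurableSet_Iic, Ioi_inter_Iic,
      ← intervalIntegral.integral_of_le hμ.le, integral_rpow (Or.inl hp),
      Real.zero_rpow (by linarith), sub_zero]
  have hne : ∀ᵐ ε ∂volume.restrict (Ioi (0 : ℝ)), ε ≠ μ :=
    ae_restrict_of_ae (Measure.ae_ne volume μ)
  rw [← hlim]
  refine tendsto_integral_filter_of_dominated_convergence
    (fun ε => Real.exp (1 + μ) * (Real.exp (-ε) * ε ^ p)) ?_ ?_ ?_ ?_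
  · refine Eventually.of_forall fun N => Measurable.aestronglyMeasurable ?_
    unfold scaledBracket
    fun_prop
  · filter_upwards [eventually_ge_atTop 1] with N hN
    filter_upwards [hne, ae_restrict_mem measurableSet_Ioi] with ε hε hpos
    have hpow : 0 ≤ ε ^ p := Real.rpow_nonneg (le_of_lt hpos) p
    rw [Real.norm_eq_abs, abs_mul, abs_of_nonneg hpow]
    calc ε ^ p * |scaledBracket N (ε - μ)| ≤ ε ^ p * Real.exp (1 - (ε - μ)) := by
          gcongr
          exact abs_scaledBracket_le hN (sub_ne_zero.2 hε)
      _ = Real.exp (1 + μ) * (Real.exp (-ε) * ε ^ p) := by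
          rw [← mul_assoc, ← Real.exp_add, mul_comm]
          ring_nf
  · have h := Real.GammaIntegral_convergent (s := p + 1) (by linarith)
    rw [add_sub_cancel_right] at h
    exact h.const_mul _
  · filter_upwards [hne] with ε hε
    rcases lt_or_gt_of_ne hε with h | h
    · rw [indicator_of_mem (mem_Iic.2 h.le)]
      simpa using (tendsto_scaledBracket_of_neg (sub_neg.2 h)).const_mul (ε ^ p)
    · rw [indicator_of_notMem (notMem_Iic.2 h)]
      simpa using (tendsto_scaledBracket_of_pos (sub_pos.2 h)).const_mul (ε ^ p)

/-- As `N → ∞`, the ratio of the energy-weighted parastatistic integral to the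
unweighted one converges to `μ(a+1)/(a+2)`: the compressibility factor of the
parastatistic gas is proportional to the chemical potential `μ`. -/
theorem parastat_compressibility_limit (μ a : ℝ) (hμ : 0 < μ) (ha : -1 < a) :
    Tendsto (fun N : ℕ =>
        (∫ ε in Set.Ioi (0 : ℝ), ε ^ (a + 1) *
          (1 / (Real.exp (ε - μ) - 1) - (N : ℝ) / (Real.exp ((N : ℝ) * (ε - μ)) - 1))) /
        (∫ ε in Set.Ioi (0 : ℝ), ε ^ a *
          (1 / (Real.exp (ε - μ) - 1) - (N : ℝ) / (Real.exp ((N : ℝ) * (ε - μ)) - 1))))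
      atTop (𝓝 (μ * (a + 1) / (a + 2))) := by
  have hnum := tendsto_integral_rpow_mul_scaledBracket hμ (p := a + 1) (by linarith)
  have hden := tendsto_integral_rpow_mul_scaledBracket hμ ha
  have ha1 : 0 < a + 1 := by linarith
  have ha2 : 0 < a + 2 := by linarith
  have hpow : 0 < μ ^ (a + 1) := Real.rpow_pos_of_pos hμ _
  have hval : μ ^ (a + 1 + 1) / (a + 1 + 1) / (μ ^ (a + 1) / (a + 1)) =
      μ * (a + 1) / (a + 2) := by
    rw [Real.rpow_add_one hμ.ne', show a + 1 + 1 = a + 2 by ring]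
    field_simp
  rw [← hval]
  refine (hnum.div hden (div_pos hpow ha1).ne').congr' ?_
  filter_upwards [eventually_ge_atTop 1] with N hN
  have hN0 : (N : ℝ) ≠ 0 := by positivity
  simp only [Pi.div_apply, bracket_eq_mul_scaledBracket hN, mul_left_comm _ (N : ℝ),
    MeasureTheory.integral_const_mul]
  rw [mul_div_mul_left _ _ hN0]
end
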